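/- arXiv:1101.1458 — 2 statements merged into one kernel-verified Lean document; each statement's English description precedes it below -/
import Mathlib

section
/- Let $W$ be a totally nonnegative $m \times n$ real matrix, let $k \geq 1$, and let $A = \{a_1 < a_2 < \dots < a_k\} \subseteq \{0,1,\dots,m-1\}$ and $B = \{b_1 < b_2 < \dots < b_k\} \subseteq \{0,1,\dots,n-1\}$. Let $T$ be the $(A,B)$-minor matrix of $W$, i.e. the matrix with entries $t_{i,j} = \det W[i+A,\, j+B]$ for $0 \le i \le m-1-a_k$ and $0 \le j \le n-1-b_k$ (indices of $W$ taken from $0$). Then every $2\times 2$ minor of $T$ is nonnegative: for all valid indices $i_1 < i_2$ and $j_1 < j_2$, one has $t_{i_1,j_1} t_{i_2,j_2} - t_{i_1,j_2} t_{i_2,j_1} \geq 0$. -/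
/-- An `m × n` real matrix is totally nonnegative if every minor (determinant of a
submatrix selected by strictly increasing row and column index maps) is nonnegative. -/
def IsTotallyNonneg {m n : ℕ} (W : Matrix (Fin m) (Fin n) ℝ) : Prop :=
  ∀ (k : ℕ) (r : Fin k → Fin m) (c : Fin k → Fin n),
    StrictMono r → StrictMono c → 0 ≤ (W.submatrix r c).det

namespace MinorTP

open Matrix Finset

theorem det_cons_perm {ι κ : Type*} {n : ℕ} (W : Matrix ι κ ℝ) (r : Fin (n+1) → ι)
    (c : Fin (n+1) → κ) (i : Fin (n+1)) :
    (W.submatrix (Fin.cons (r i) (r ∘ i.succAbove) : Fin (n+1) → ι) c).det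
      = (-1) ^ (i : ℕ) * (W.submatrix r c).det := by
  have h : (Fin.cons (r i) (r ∘ i.succAbove) : Fin (n+1) → ι) = r ∘ i.cycleRange.symm := by
    funext j
    refine Fin.cases ?_ (fun j => ?_) j <;> simp
  have h2 := det_permute i.cycleRange.symm (W.submatrix r c)
  rw [submatrix_submatrix] at h2
  rw [h]
  rw [Function.comp_id] at h2
  rw [h2]
  simp [Equiv.Perm.sign_symm, Fin.sign_cycleRange]

theorem det_cons_cons_perm {ι κ : Type*} {n : ℕ} (W : Matrix ι κ ℝ) (x : ι) (r : Fin (n+1) → ι)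
    (c : Fin (n+2) → κ) (i : Fin (n+1)) :
    (W.submatrix (Fin.cons x (Fin.cons (r i) (r ∘ i.succAbove) : Fin (n+1) → ι) : Fin (n+2) → ι)
      c).det
      = (-1) ^ (i : ℕ) * (W.submatrix (Fin.cons x r : Fin (n+2) → ι) c).det := by
  rw [det_succ_row_zero, det_succ_row_zero, Finset.mul_sum]
  refine Finset.sum_congr rfl fun j _ => ?_
  have := det_cons_perm W r (c ∘ j.succAbove) i
  have e : ∀ q : Fin (n+1) → ι, (W.submatrix (Fin.cons x q : Fin (n+2) → ι) c).submatrix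
      Fin.succ j.succAbove = W.submatrix q (c ∘ j.succAbove) := by
    intro q; ext a b; simp
  rw [e, e, this]
  simp
  ring

theorem comm_succAbove {n : ℕ} (s : Fin (n+1)) (j : Fin n) :
    s.succ.succAbove (s.succAbove j) = s.castSucc.succAbove (s.succAbove j) := by
  ext
  simp only [Fin.succAbove, Fin.lt_def, Fin.val_castSucc, Fin.val_succ]
  split_ifs <;> simp_all <;> omega

/-- moving an adjacent pair to the front does not change the determinant -/
theorem det_pair_front {ι κ : Type*} {n : ℕ} (W : Matrix ι κ ℝ) (r : Fin (n+2) → ι)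
    (c : Fin (n+2) → κ) (s : Fin (n+1)) :
    (W.submatrix (Fin.cons (r s.castSucc) (Fin.cons (r s.succ)
      (r ∘ s.succ.succAbove ∘ s.succAbove) : Fin (n+1) → ι) : Fin (n+2) → ι) c).det
      = (W.submatrix r c).det := by
  have h1 := det_cons_perm W r c s.castSucc
  have h2 := det_cons_cons_perm W (r s.castSucc) (r ∘ s.castSucc.succAbove) c s
  have e : (r ∘ s.castSucc.succAbove) ∘ s.succAbove = r ∘ s.succ.succAbove ∘ s.succAbove := by
    funext j; simp [comm_succAbove]
  have e2 : (r ∘ s.castSucc.succAbove) s = r s.succ := by simp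
  rw [e, e2, h1] at h2
  rw [h2, ← mul_assoc, ← pow_add]
  simp

theorem det_pair_front' {ι κ : Type*} {n : ℕ} (W : Matrix ι κ ℝ) (r : Fin (n+2) → ι)
    (c : Fin (n+2) → κ) (s t : Fin (n+1)) :
    (W.submatrix (Fin.cons (r s.castSucc) (Fin.cons (r s.succ)
      (r ∘ s.succ.succAbove ∘ s.succAbove) : Fin (n+1) → ι) : Fin (n+2) → ι)
      (Fin.cons (c t.castSucc) (Fin.cons (c t.succ)
      (c ∘ t.succ.succAbove ∘ t.succAbove) : Fin (n+1) → κ) : Fin (n+2) → κ)).det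
      = (W.submatrix r c).det := by
  rw [det_pair_front, ← det_transpose, transpose_submatrix, det_pair_front, ← transpose_submatrix,
    det_transpose]

theorem det_cons_perm' {ι κ : Type*} {n : ℕ} (W : Matrix ι κ ℝ) (r : Fin (n+1) → ι)
    (c : Fin (n+1) → κ) (i j : Fin (n+1)) :
    (W.submatrix (Fin.cons (r i) (r ∘ i.succAbove) : Fin (n+1) → ι)
      (Fin.cons (c j) (c ∘ j.succAbove) : Fin (n+1) → κ)).det
      = (-1) ^ (i : ℕ) * ((-1) ^ (j : ℕ) * (W.submatrix r c).det) := by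
  rw [det_cons_perm, ← det_transpose, transpose_submatrix, det_cons_perm, ← transpose_submatrix,
    det_transpose]

def eqv1 (k : ℕ) : Fin 1 ⊕ Fin k ≃ Fin (k+1) := finSumFinEquiv.trans (finCongr (add_comm 1 k))
def eqv2 (k : ℕ) : Fin 2 ⊕ Fin k ≃ Fin (k+2) := finSumFinEquiv.trans (finCongr (add_comm 2 k))

theorem eqv1_inl (k : ℕ) (i : Fin 1) : eqv1 k (Sum.inl i) = 0 := by
  ext; simp [eqv1]
theorem eqv1_inr (k : ℕ) (i : Fin k) : eqv1 k (Sum.inr i) = i.succ := by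
  ext; simp [eqv1]
theorem eqv2_inl0 (k : ℕ) : eqv2 k (Sum.inl 0) = 0 := by
  ext; simp [eqv2]
theorem eqv2_inl1 (k : ℕ) : eqv2 k (Sum.inl 1) = (0 : Fin (k+1)).succ := by
  ext; simp [eqv2]
theorem eqv2_inr (k : ℕ) (i : Fin k) : eqv2 k (Sum.inr i) = i.succ.succ := by
  ext; simp [eqv2]

theorem schur1 {ι κ : Type*} {k : ℕ} (W : Matrix ι κ ℝ) (S : Fin k → ι) (U : Fin k → κ)
    (h : (W.submatrix S U).det ≠ 0) (x : ι) (y : κ) :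
    (W.submatrix (Fin.cons x S : Fin (k+1) → ι) (Fin.cons y U : Fin (k+1) → κ)).det
      = (W.submatrix S U).det *
        (W - W.submatrix id U * (W.submatrix S U)⁻¹ * W.submatrix S id) x y := by
  have : Invertible (W.submatrix S U) := invertibleOfIsUnitDet _ (isUnit_iff_ne_zero.2 h)
  rw [← det_submatrix_equiv_self (eqv1 k)]
  have e : (W.submatrix (Fin.cons x S : Fin (k+1) → ι) (Fin.cons y U : Fin (k+1) → κ)).submatrix
      (eqv1 k) (eqv1 k) = fromBlocks (W.submatrix (fun _ => x) (fun _ => y))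
        (W.submatrix (fun _ => x) U) (W.submatrix S (fun _ => y)) (W.submatrix S U) := by
    ext i j
    rcases i with i | i <;> rcases j with j | j <;> simp [eqv1_inl, eqv1_inr]
  rw [e, det_fromBlocks₂₂, det_fin_one, invOf_eq_nonsing_inv]
  rfl

theorem schur2 {ι κ : Type*} {k : ℕ} (W : Matrix ι κ ℝ) (S : Fin k → ι) (U : Fin k → κ)
    (h : (W.submatrix S U).det ≠ 0) (x x' : ι) (y y' : κ) :
    (W.submatrix (Fin.cons x (Fin.cons x' S : Fin (k+1) → ι) : Fin (k+2) → ι)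
      (Fin.cons y (Fin.cons y' U : Fin (k+1) → κ) : Fin (k+2) → κ)).det
      = (W.submatrix S U).det *
        (((W - W.submatrix id U * (W.submatrix S U)⁻¹ * W.submatrix S id).submatrix
          ![x, x'] ![y, y']).det) := by
  have : Invertible (W.submatrix S U) := invertibleOfIsUnitDet _ (isUnit_iff_ne_zero.2 h)
  rw [← det_submatrix_equiv_self (eqv2 k)]
  have e : (W.submatrix (Fin.cons x (Fin.cons x' S : Fin (k+1) → ι) : Fin (k+2) → ι)
      (Fin.cons y (Fin.cons y' U : Fin (k+1) → κ) : Fin (k+2) → κ)).submatrix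
      (eqv2 k) (eqv2 k) = fromBlocks (W.submatrix ![x, x'] ![y, y'])
        (W.submatrix ![x, x'] U) (W.submatrix S ![y, y']) (W.submatrix S U) := by
    ext i j
    rcases i with i | i <;> rcases j with j | j <;> (try fin_cases i) <;> (try fin_cases j) <;>
      simp [eqv2_inl0, eqv2_inl1, eqv2_inr, -Fin.succ_zero_eq_one, -Fin.succ_zero_eq_one',
        -submatrix_cons_row]
  rw [e, det_fromBlocks₂₂, invOf_eq_nonsing_inv]
  rfl

theorem sylvester {ι κ : Type*} {k : ℕ} (W : Matrix ι κ ℝ) (S : Fin k → ι) (U : Fin k → κ)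
    (h : (W.submatrix S U).det ≠ 0) (x x' : ι) (y y' : κ) :
    (W.submatrix (Fin.cons x S : Fin (k+1) → ι) (Fin.cons y U : Fin (k+1) → κ)).det *
    (W.submatrix (Fin.cons x' S : Fin (k+1) → ι) (Fin.cons y' U : Fin (k+1) → κ)).det -
    (W.submatrix (Fin.cons x S : Fin (k+1) → ι) (Fin.cons y' U : Fin (k+1) → κ)).det *
    (W.submatrix (Fin.cons x' S : Fin (k+1) → ι) (Fin.cons y U : Fin (k+1) → κ)).det =
    (W.submatrix S U).det *
    (W.submatrix (Fin.cons x (Fin.cons x' S : Fin (k+1) → ι) : Fin (k+2) → ι)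
      (Fin.cons y (Fin.cons y' U : Fin (k+1) → κ) : Fin (k+2) → κ)).det := by
  rw [schur2 W S U h, schur1 W S U h, schur1 W S U h, schur1 W S U h, schur1 W S U h, det_fin_two]
  simp only [submatrix_apply, cons_val_zero, cons_val_one]
  ring

/-- Local step. -/
theorem local_step {ι κ : Type*} {k : ℕ} (W : Matrix ι κ ℝ) (R : Fin (k+2) → ι)
    (C : Fin (k+2) → κ) (s t : Fin (k+1))
    (hD : 0 < (W.submatrix (R ∘ s.succ.succAbove ∘ s.succAbove)
      (C ∘ t.succ.succAbove ∘ t.succAbove)).det)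
    (hM : 0 ≤ (W.submatrix R C).det) :
    (W.submatrix (R ∘ s.succ.succAbove) (C ∘ t.castSucc.succAbove)).det *
    (W.submatrix (R ∘ s.castSucc.succAbove) (C ∘ t.succ.succAbove)).det ≤
    (W.submatrix (R ∘ s.succ.succAbove) (C ∘ t.succ.succAbove)).det *
    (W.submatrix (R ∘ s.castSucc.succAbove) (C ∘ t.castSucc.succAbove)).det := by
  have key := sylvester W _ _ hD.ne' (R s.castSucc) (R s.succ) (C t.castSucc) (C t.succ)
  rw [det_pair_front'] at key
  have e1 : ∀ {α : Type _} (R : Fin (k+2) → α) (s : Fin (k+1)),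
      (Fin.cons (R s.castSucc) (R ∘ s.succ.succAbove ∘ s.succAbove) : Fin (k+1) → α)
      = Fin.cons ((R ∘ s.succ.succAbove) s) ((R ∘ s.succ.succAbove) ∘ s.succAbove) := by
    intro α R s
    congr 1
    simp
  have e2 : ∀ {α : Type _} (R : Fin (k+2) → α) (s : Fin (k+1)),
      (Fin.cons (R s.succ) (R ∘ s.succ.succAbove ∘ s.succAbove) : Fin (k+1) → α)
      = Fin.cons ((R ∘ s.castSucc.succAbove) s) ((R ∘ s.castSucc.succAbove) ∘ s.succAbove) := by
    intro α R s
    congr 1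
    · simp
    · funext j; simp [comm_succAbove]
  have e1' : (Fin.cons (C t.castSucc) (C ∘ t.succ.succAbove ∘ t.succAbove) : Fin (k+1) → κ)
      = Fin.cons ((C ∘ t.succ.succAbove) t) ((C ∘ t.succ.succAbove) ∘ t.succAbove) := by
    congr 1
    simp
  have e2' : (Fin.cons (C t.succ) (C ∘ t.succ.succAbove ∘ t.succAbove) : Fin (k+1) → κ)
      = Fin.cons ((C ∘ t.castSucc.succAbove) t) ((C ∘ t.castSucc.succAbove) ∘ t.succAbove) := by
    congr 1
    · simp
    · funext j; simp [comm_succAbove]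
  rw [e1 R s, e2 R s, e1', e2'] at key
  simp only [det_cons_perm'] at key
  have hp := mul_nonneg hD.le hM
  rw [← key] at hp
  have q : ∀ n : ℕ, ((-1 : ℝ) ^ n) ^ 2 = 1 := fun n => by rw [← pow_mul, mul_comm]; simp
  have q1 := q s
  have q2 := q t
  generalize (-1 : ℝ) ^ (s : ℕ) = u at *
  generalize (-1 : ℝ) ^ (t : ℕ) = v at *
  have : 0 ≤ (u ^ 2 * v ^ 2) *
      ((W.submatrix (R ∘ s.succ.succAbove) (C ∘ t.succ.succAbove)).det *
      (W.submatrix (R ∘ s.castSucc.succAbove) (C ∘ t.castSucc.succAbove)).det -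
      (W.submatrix (R ∘ s.succ.succAbove) (C ∘ t.castSucc.succAbove)).det *
      (W.submatrix (R ∘ s.castSucc.succAbove) (C ∘ t.succ.succAbove)).det) := by
    linarith
  rw [q1, q2] at this
  linarith

theorem telescope (f : ℕ → ℕ → ℝ) (K L : ℕ) (hpos : ∀ s ≤ K, ∀ t ≤ L, 0 < f s t)
    (h : ∀ s < K, ∀ t < L, f s (t+1) * f (s+1) t ≤ f s t * f (s+1) (t+1)) :
    f 0 L * f K 0 ≤ f 0 0 * f K L := by
  have step : ∀ s < K, ∀ t ≤ L, f s t * f (s+1) 0 ≤ f s 0 * f (s+1) t := by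
    intro s hs t
    induction t with
    | zero => intro _; rfl
    | succ t ih =>
      intro ht
      have a := ih (by omega)
      have b := h s hs t (by omega)
      have p1 := hpos s hs.le t (by omega)
      have p2 := hpos (s+1) hs t (by omega)
      have p3 := hpos s hs.le (t+1) ht
      have p4 := hpos (s+1) hs (t+1) ht
      have p5 := hpos (s+1) hs 0 (by omega)
      have p6 := hpos s hs.le 0 (by omega)
      have := mul_le_mul a b (by positivity) (by positivity)
      refine le_of_mul_le_mul_left ?_ (mul_pos p1 p2)
      linarith
  have : ∀ s ≤ K, f 0 L * f s 0 ≤ f 0 0 * f s L := by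
    intro s
    induction s with
    | zero => intro _; linarith
    | succ s ih =>
      intro hs
      have a := ih (by omega)
      have b := step s (by omega) L le_rfl
      have p1 := hpos s (by omega) 0 (by omega)
      have p2 := hpos s (by omega) L le_rfl
      have p3 := hpos (s+1) hs 0 (by omega)
      have p4 := hpos (s+1) hs L le_rfl
      have p5 := hpos 0 (by omega) 0 (by omega)
      have := mul_le_mul a b (by positivity) (by positivity)
      refine le_of_mul_le_mul_left ?_ (mul_pos p1 p2)
      linarith
  exact this K le_rfl

theorem cauchyBinet {k N : ℕ} (A : Matrix (Fin k) (Fin N) ℝ) (B : Matrix (Fin N) (Fin k) ℝ) :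
    (k.factorial : ℝ) * (A * B).det =
      ∑ f : Fin k → Fin N, (A.submatrix id f).det * (B.submatrix f id).det := by
  have h1 : (A * B).det = ∑ f : Fin k → Fin N, (A.submatrix id f).det * ∏ i, B (f i) i := by
    simp only [det_apply', mul_apply, prod_univ_sum, mul_sum, Fintype.piFinset_univ]
    rw [Finset.sum_comm]
    refine Finset.sum_congr rfl fun f _ => ?_
    rw [Finset.sum_mul]
    refine Finset.sum_congr rfl fun σ _ => ?_
    simp [Finset.prod_mul_distrib, mul_assoc]
  have h2 : ∀ τ : Equiv.Perm (Fin k), ∑ f : Fin k → Fin N, (A.submatrix id f).det *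
      ((Equiv.Perm.sign τ : ℤ) * ∏ i, B (f (τ i)) i) = (A * B).det := by
    intro τ
    rw [h1]
    refine Fintype.sum_equiv (Equiv.arrowCongr τ.symm (Equiv.refl _)) _ _ fun f => ?_
    have := det_permute' τ (A.submatrix id f)
    rw [submatrix_submatrix, Function.comp_id] at this
    have e : (Equiv.arrowCongr τ.symm (Equiv.refl (Fin N))) f = f ∘ τ := by
      funext i; simp [Equiv.arrowCongr]
    rw [e, this]
    simp only [Function.comp]
    ring
  have h3 : ∀ f : Fin k → Fin N, (A.submatrix id f).det * (B.submatrix f id).det =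
      ∑ τ : Equiv.Perm (Fin k), (A.submatrix id f).det *
      ((Equiv.Perm.sign τ : ℤ) * ∏ i, B (f (τ i)) i) := by
    intro f
    rw [det_apply' (B.submatrix f id), Finset.mul_sum]
    rfl
  simp_rw [h3]
  rw [Finset.sum_comm]
  simp_rw [h2]
  simp [Fintype.card_perm]

theorem cb_term {k N : ℕ} (A : Matrix (Fin k) (Fin N) ℝ) (B : Matrix (Fin N) (Fin k) ℝ)
    (h : ∀ f : Fin k → Fin N, StrictMono f → 0 ≤ (A.submatrix id f).det * (B.submatrix f id).det)
    (f : Fin k → Fin N) : 0 ≤ (A.submatrix id f).det * (B.submatrix f id).det := by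
  by_cases hf : Function.Injective f
  · have hs : StrictMono (f ∘ Tuple.sort f) :=
      (Tuple.monotone_sort f).strictMono_of_injective (hf.comp (Tuple.sort f).injective)
    have := h _ hs
    have a := det_permute' (Tuple.sort f) (A.submatrix id f)
    have b := det_permute (Tuple.sort f) (B.submatrix f id)
    rw [submatrix_submatrix, Function.comp_id] at a b
    rw [a, b] at this
    rcases Int.units_eq_one_or (Equiv.Perm.sign (Tuple.sort f)) with e | e <;>
      rw [e] at this <;> simpa using this
  · simp only [Function.Injective, not_forall] at hf
    obtain ⟨i, j, hij, hne⟩ := hf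
    have : (B.submatrix f id).det = 0 := by
      refine det_zero_of_row_eq hne ?_
      funext l; simp [hij]
    rw [this, mul_zero]

theorem cb_nonneg {k N : ℕ} (A : Matrix (Fin k) (Fin N) ℝ) (B : Matrix (Fin N) (Fin k) ℝ)
    (h : ∀ f : Fin k → Fin N, StrictMono f → 0 ≤ (A.submatrix id f).det * (B.submatrix f id).det) :
    0 ≤ (A * B).det := by
  have h1 : 0 ≤ (k.factorial : ℝ) * (A * B).det := by
    rw [cauchyBinet]
    exact Finset.sum_nonneg fun f _ => cb_term A B h f
  exact nonneg_of_mul_nonneg_right h1 (by positivity)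

theorem cb_pos {k N : ℕ} (A : Matrix (Fin k) (Fin N) ℝ) (B : Matrix (Fin N) (Fin k) ℝ)
    (h : ∀ f : Fin k → Fin N, StrictMono f → 0 ≤ (A.submatrix id f).det * (B.submatrix f id).det)
    (f : Fin k → Fin N) (hf : 0 < (A.submatrix id f).det * (B.submatrix f id).det) :
    0 < (A * B).det := by
  have h1 : 0 < (k.factorial : ℝ) * (A * B).det := by
    rw [cauchyBinet]
    exact Finset.sum_pos' (fun f _ => cb_term A B h f) ⟨f, Finset.mem_univ _, hf⟩
  exact pos_of_mul_pos_right h1 (by positivity)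

def TP {m n : ℕ} (W : Matrix (Fin m) (Fin n) ℝ) : Prop :=
  ∀ (k : ℕ) (r : Fin k → Fin m) (c : Fin k → Fin n),
    StrictMono r → StrictMono c → 0 < (W.submatrix r c).det

theorem TP.tn {m n : ℕ} {W : Matrix (Fin m) (Fin n) ℝ} (h : TP W) : IsTotallyNonneg W :=
  fun k r c hr hc => (h k r c hr hc).le

theorem sub_mul_eq {m n l k : ℕ} (A : Matrix (Fin m) (Fin n) ℝ) (B : Matrix (Fin n) (Fin l) ℝ)
    (r : Fin k → Fin m) (c : Fin k → Fin l) :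
    (A * B).submatrix r c = A.submatrix r id * B.submatrix id c := by
  ext i j; simp [mul_apply]

theorem tn_mul {m n l : ℕ} {A : Matrix (Fin m) (Fin n) ℝ} {B : Matrix (Fin n) (Fin l) ℝ}
    (hA : IsTotallyNonneg A) (hB : IsTotallyNonneg B) : IsTotallyNonneg (A * B) := by
  intro k r c hr hc
  rw [sub_mul_eq]
  exact cb_nonneg _ _ fun f hf => mul_nonneg (hA k r f hr hf) (hB k f c hf hc)

theorem smooth_pos {m n k : ℕ} {F : Matrix (Fin m) (Fin m) ℝ} {W : Matrix (Fin m) (Fin n) ℝ}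
    {G : Matrix (Fin n) (Fin n) ℝ} (hF : TP F) (hW : IsTotallyNonneg W) (hG : TP G)
    (r₀ : Fin k → Fin m) (c₀ : Fin k → Fin n) (hr₀ : StrictMono r₀) (hc₀ : StrictMono c₀)
    (h0 : (W.submatrix r₀ c₀).det ≠ 0) (r : Fin k → Fin m) (c : Fin k → Fin n)
    (hr : StrictMono r) (hc : StrictMono c) : 0 < ((F * W * G).submatrix r c).det := by
  have h0' := lt_of_le_of_ne (hW k r₀ c₀ hr₀ hc₀) h0.symm
  have h1 : 0 < ((F * W).submatrix r c₀).det := by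
    rw [sub_mul_eq]
    exact cb_pos _ _ (fun f hf => mul_nonneg (hF k r f hr hf).le (hW k f c₀ hf hc₀)) r₀
      (mul_pos (hF k r r₀ hr hr₀) h0')
  rw [sub_mul_eq]
  exact cb_pos _ _ (fun f hf => mul_nonneg (tn_mul hF.tn hW k r f hr hf) (hG k f c hf hc).le) c₀
      (mul_pos h1 (hG k c₀ c hc₀ hc))

theorem cauchy_pos : ∀ (k : ℕ) (x y : Fin k → ℝ), (∀ i, 0 < x i) → (∀ i, 0 < y i) →
    StrictMono x → StrictMono y → 0 < (Matrix.of fun i j => 1 / (x i + y j)).det := by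
  intro k
  induction k with
  | zero => intros; simp
  | succ k ih =>
    intro x y hx hy hxm hym
    set W : Matrix (Fin (k+1)) (Fin (k+1)) ℝ := Matrix.of fun i j => 1 / (x i + y j) with hW
    let B : Matrix (Fin (k+1)) (Fin (k+1)) ℝ := Matrix.of fun i j =>
      if i = 0 then W i j else W i j - (x 0 + y 0) / (x i + y 0) * W 0 j
    have hdet : W.det = B.det := by
      refine det_eq_of_forall_row_eq_smul_add_const
        (fun i => if i = 0 then 0 else (x 0 + y 0) / (x i + y 0)) 0 (by simp) ?_
      intro i j
      by_cases hi : i = 0 <;> simp [B, hi]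
    have h00 : B.det = B 0 0 * (B.submatrix Fin.succ Fin.succ).det := by
      rw [det_succ_column_zero, Fin.sum_univ_succ]
      rw [Finset.sum_eq_zero]
      · simp
      · intro i _
        have : B i.succ 0 = 0 := by
          have := hx 0; have := hy 0; have := hx i.succ
          simp [B, hW, Fin.succ_ne_zero]
          field_simp
          simp
        rw [this]; simp
    have hs : B.submatrix Fin.succ Fin.succ = Matrix.of fun i j =>
        ((x i.succ - x 0) / (x i.succ + y 0)) * ((Matrix.of fun i j =>
        ((y (Fin.succ j) - y 0) / (x 0 + y j.succ)) *
          (Matrix.of fun i j => 1 / (x (Fin.succ i) + y (Fin.succ j))) i j :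
          Matrix (Fin k) (Fin k) ℝ) i j) := by
      ext i j
      have := hx 0; have := hy 0; have := hx i.succ; have := hy j.succ
      simp [B, hW, Fin.succ_ne_zero]
      field_simp
      ring
    rw [hdet, h00, hs, det_mul_column, det_mul_row]
    have h0 : 0 < B 0 0 := by
      have := hx 0; have := hy 0
      simp [B, hW]; positivity
    have p1 : 0 < ∏ i : Fin k, ((x i.succ - x 0) / (x i.succ + y 0)) := by
      refine Finset.prod_pos fun i _ => div_pos (sub_pos.2 (hxm (Fin.succ_pos i))) ?_
      have := hy 0; have := hx i.succ; positivity
    have p2 : 0 < ∏ i : Fin k, ((y i.succ - y 0) / (x 0 + y i.succ)) := by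
      refine Finset.prod_pos fun i _ => div_pos (sub_pos.2 (hym (Fin.succ_pos i))) ?_
      have := hx 0; have := hy i.succ; positivity
    have p3 := ih (fun i => x i.succ) (fun i => y i.succ) (fun i => hx _) (fun i => hy _)
      (fun a b h => hxm (Fin.succ_lt_succ_iff.2 h)) (fun a b h => hym (Fin.succ_lt_succ_iff.2 h))
    exact mul_pos h0 (mul_pos p1 (mul_pos p2 p3))

noncomputable def F (m : ℕ) (M : ℝ) : Matrix (Fin m) (Fin m) ℝ := Matrix.of fun i j =>
  (2 * M ^ (i : ℕ)) * ((Matrix.of fun i j : Fin m => M ^ (j : ℕ) *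
    (Matrix.of fun i j : Fin m => 1 / (M ^ (2 * (i : ℕ)) + M ^ (2 * (j : ℕ)))) i j) i j)

theorem F_TP (m : ℕ) (M : ℝ) (hM : 1 < M) : TP (F m M) := by
  intro k r c hr hc
  have h0 : 0 < M := by linarith
  have e : (F m M).submatrix r c = Matrix.of fun i j =>
      (2 * M ^ (r i : ℕ)) * ((Matrix.of fun i j : Fin k => M ^ (c j : ℕ) *
      (Matrix.of fun i j : Fin k => 1 / (M ^ (2 * (r i : ℕ)) + M ^ (2 * (c j : ℕ)))) i j) i j) := rfl
  rw [e, det_mul_column, det_mul_row]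
  have hm : ∀ q : Fin k → Fin m, StrictMono q → StrictMono fun i => M ^ (2 * (q i : ℕ)) := by
    intro q hq a b hab
    have : (q a : ℕ) < q b := hq hab
    exact pow_lt_pow_right₀ hM (by omega)
  have := cauchy_pos k (fun i => M ^ (2 * (r i : ℕ))) (fun i => M ^ (2 * (c i : ℕ)))
    (fun i => by positivity) (fun i => by positivity) (hm r hr) (hm c hc)
  refine mul_pos (Finset.prod_pos fun i _ => by positivity)
    (mul_pos (Finset.prod_pos fun i _ => by positivity) this)

theorem F_bound (i j : ℕ) (hij : i ≠ j) (M : ℝ) (hM : 1 < M) :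
    (2 * M ^ i) * (M ^ j * (1 / (M ^ (2 * i) + M ^ (2 * j)))) ≤ 2 / M := by
  have h0 : 0 < M := by linarith
  rw [le_div_iff₀ h0]
  have : M ^ (i + j + 1) ≤ M ^ (2 * i) + M ^ (2 * j) := by
    rcases lt_or_gt_of_ne hij with h | h
    · have := pow_le_pow_right₀ hM.le (show i + j + 1 ≤ 2 * j by omega)
      have : 0 < M ^ (2 * i) := by positivity
      linarith
    · have := pow_le_pow_right₀ hM.le (show i + j + 1 ≤ 2 * i by omega)
      have : 0 < M ^ (2 * j) := by positivity
      linarith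
  have e : 2 * M ^ i * (M ^ j * (1 / (M ^ (2 * i) + M ^ (2 * j)))) * M
    = 2 * (M ^ (i + j + 1) / (M ^ (2 * i) + M ^ (2 * j))) := by
    rw [pow_add, pow_add]; ring
  rw [e]
  have : M ^ (i + j + 1) / (M ^ (2 * i) + M ^ (2 * j)) ≤ 1 := by
    rw [div_le_one (by positivity)]; exact this
  linarith

theorem F_tendsto (m : ℕ) : Filter.Tendsto (F m) Filter.atTop (nhds 1) := by
  refine tendsto_pi_nhds.2 fun i => tendsto_pi_nhds.2 fun j => ?_
  by_cases hij : i = j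
  · subst hij
    refine Filter.Tendsto.congr' ?_ tendsto_const_nhds
    filter_upwards [Filter.eventually_gt_atTop (1 : ℝ)] with M hM
    have h0 : 0 < M := by linarith
    simp [F]
    field_simp
    ring
  · rw [one_apply_ne hij]
    have h2 : Filter.Tendsto (fun M : ℝ => 2 / M) Filter.atTop (nhds 0) :=
      Filter.Tendsto.div_atTop tendsto_const_nhds Filter.tendsto_id
    refine tendsto_of_tendsto_of_tendsto_of_le_of_le' tendsto_const_nhds h2 ?_ ?_
    · filter_upwards [Filter.eventually_gt_atTop (1 : ℝ)] with M hM
      have h0 : 0 < M := by linarith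
      simp only [F, of_apply]
      positivity
    · filter_upwards [Filter.eventually_gt_atTop (1 : ℝ)] with M hM
      exact F_bound i j (fun h => hij (Fin.ext h)) M hM

/-- hybrid index function -/
def hyb {k m : ℕ} (r r' : Fin k → Fin m) (s : ℕ) : Fin k → Fin m :=
  fun p => if p.val < s then r p else r' p

theorem hyb_strictMono {k m : ℕ} {r r' : Fin k → Fin m} (hr : StrictMono r) (hr' : StrictMono r')
    (h : ∀ p, r p < r' p) (s : ℕ) : StrictMono (hyb r r' s) := by
  intro p q hpq
  have h1 := hr hpq
  have h2 := hr' hpq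
  have h3 := h p
  have h4 := h q
  have : p.val < q.val := hpq
  unfold hyb
  split_ifs
  · exact h1
  · exact h1.trans h4
  · omega
  · exact h2

def big {k m : ℕ} (r r' : Fin (k+1) → Fin m) (s : Fin (k+1)) : Fin (k+2) → Fin m :=
  fun p => if h : p.val ≤ s.val then r ⟨p.val, by omega⟩ else r' ⟨p.val - 1, by omega⟩

theorem big_strictMono {k m : ℕ} {r r' : Fin (k+1) → Fin m} (hr : StrictMono r)
    (hr' : StrictMono r') (h : ∀ p, r p < r' p) (s : Fin (k+1)) : StrictMono (big r r' s) := by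
  intro p q hpq
  have hv : p.val < q.val := hpq
  unfold big
  split_ifs with h1 h2
  · exact hr hv
  · exact (h _).trans_le (hr'.monotone (by rw [Fin.le_def]; simp; omega))
  · omega
  · exact hr' (by rw [Fin.lt_def]; simp; omega)

theorem big_del_castSucc {k m : ℕ} (r r' : Fin (k+1) → Fin m) (s : Fin (k+1)) :
    big r r' s ∘ s.castSucc.succAbove = hyb r r' s := by
  funext p
  simp only [Function.comp, big, hyb, Fin.succAbove, Fin.lt_def, Fin.val_castSucc]
  by_cases h : p.val < s.val
  · simp [h, h.le]
  · have : ¬ (p.val + 1 ≤ s.val) := by omega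
    simp [h, this]

theorem big_del_succ {k m : ℕ} (r r' : Fin (k+1) → Fin m) (s : Fin (k+1)) :
    big r r' s ∘ s.succ.succAbove = hyb r r' (s + 1) := by
  funext p
  simp only [Function.comp, big, hyb, Fin.succAbove, Fin.lt_def, Fin.val_castSucc, Fin.val_succ]
  by_cases h : p.val < s.val + 1
  · have : p.val ≤ s.val := by omega
    simp [h, this]
  · have : ¬ (p.val + 1 ≤ s.val) := by omega
    simp [h, this]

theorem main_pos {m n k : ℕ} {W : Matrix (Fin m) (Fin n) ℝ} (hW : IsTotallyNonneg W)
    (h0 : ∀ (r : Fin k → Fin m) (c : Fin k → Fin n), StrictMono r → StrictMono c →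
      0 < (W.submatrix r c).det)
    (h1 : ∀ (r : Fin (k+1) → Fin m) (c : Fin (k+1) → Fin n), StrictMono r → StrictMono c →
      0 < (W.submatrix r c).det)
    (r r' : Fin (k+1) → Fin m) (c c' : Fin (k+1) → Fin n)
    (hr : StrictMono r) (hr' : StrictMono r') (hc : StrictMono c) (hc' : StrictMono c')
    (hrr : ∀ p, r p < r' p) (hcc : ∀ p, c p < c' p) :
    (W.submatrix r c').det * (W.submatrix r' c).det ≤
      (W.submatrix r c).det * (W.submatrix r' c').det := by
  have key := telescope (fun s t => (W.submatrix (hyb r r' s) (hyb c c' t)).det) (k+1) (k+1)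
    (fun s _ t _ => h1 _ _ (hyb_strictMono hr hr' hrr s) (hyb_strictMono hc hc' hcc t)) ?_
  · have e0 : ∀ {m : ℕ} (r r' : Fin (k+1) → Fin m), hyb r r' 0 = r' := by
      intro m r r'; funext p; simp [hyb]
    have e1 : ∀ {m : ℕ} (r r' : Fin (k+1) → Fin m), hyb r r' (k+1) = r := by
      intro m r r'; funext p; exact if_pos p.isLt
    simp only [e0, e1] at key
    linarith
  · intro s hs t ht
    have hR := big_strictMono hr hr' hrr ⟨s, hs⟩
    have hC := big_strictMono hc hc' hcc ⟨t, ht⟩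
    have := local_step W (big r r' ⟨s, hs⟩) (big c c' ⟨t, ht⟩) ⟨s, hs⟩ ⟨t, ht⟩
      (h0 _ _ (hR.comp ((Fin.strictMono_succAbove _).comp (Fin.strictMono_succAbove _)))
        (hC.comp ((Fin.strictMono_succAbove _).comp (Fin.strictMono_succAbove _))))
      (hW _ _ _ hR hC)
    simp only [big_del_succ, big_del_castSucc] at this
    linarith

theorem main {m n k : ℕ} {W : Matrix (Fin m) (Fin n) ℝ} (hW : IsTotallyNonneg W)
    (r r' : Fin (k+1) → Fin m) (c c' : Fin (k+1) → Fin n)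
    (hr : StrictMono r) (hr' : StrictMono r') (hc : StrictMono c) (hc' : StrictMono c')
    (hrr : ∀ p, r p < r' p) (hcc : ∀ p, c p < c' p) :
    0 ≤ (W.submatrix r c).det * (W.submatrix r' c').det -
      (W.submatrix r c').det * (W.submatrix r' c).det := by
  by_cases hz : ∃ (r₀ : Fin (k+1) → Fin m) (c₀ : Fin (k+1) → Fin n), StrictMono r₀ ∧
      StrictMono c₀ ∧ (W.submatrix r₀ c₀).det ≠ 0
  · obtain ⟨r₀, c₀, hr₀, hc₀, hne⟩ := hz
    obtain ⟨j, hj⟩ : ∃ j : Fin (k+1),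
        (W.submatrix (r₀ ∘ Fin.succ) (c₀ ∘ j.succAbove)).det ≠ 0 := by
      by_contra hcon
      push Not at hcon
      apply hne
      rw [det_succ_row_zero]
      refine Finset.sum_eq_zero fun j _ => ?_
      rw [submatrix_submatrix, hcon j, mul_zero]
    let Φ : Matrix (Fin m) (Fin m) ℝ × Matrix (Fin n) (Fin n) ℝ → ℝ := fun P =>
      ((P.1 * W * P.2).submatrix r c).det * ((P.1 * W * P.2).submatrix r' c').det -
      ((P.1 * W * P.2).submatrix r c').det * ((P.1 * W * P.2).submatrix r' c).det
    have hb : Continuous fun P : Matrix (Fin m) (Fin m) ℝ × Matrix (Fin n) (Fin n) ℝ =>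
        P.1 * W * P.2 := by fun_prop
    have hΦ : Continuous Φ := by
      have : ∀ (r : Fin (k+1) → Fin m) (c : Fin (k+1) → Fin n), Continuous
          fun P : Matrix (Fin m) (Fin m) ℝ × Matrix (Fin n) (Fin n) ℝ =>
          ((P.1 * W * P.2).submatrix r c).det := fun r c => (hb.matrix_submatrix r c).matrix_det
      exact ((this r c).mul (this r' c')).sub ((this r c').mul (this r' c))
    have ht : Filter.Tendsto (fun M => Φ (F m M, F n M)) Filter.atTop (nhds (Φ (1, 1))) :=
      (hΦ.tendsto _).comp ((F_tendsto m).prodMk_nhds (F_tendsto n))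
    have h1 : Φ (1, 1) = (W.submatrix r c).det * (W.submatrix r' c').det -
      (W.submatrix r c').det * (W.submatrix r' c).det := by simp [Φ]
    rw [← h1]
    refine ge_of_tendsto ht ?_
    filter_upwards [Filter.eventually_gt_atTop (1 : ℝ)] with M hM
    have hFm := F_TP m M hM
    have hFn := F_TP n M hM
    have := main_pos (k := k) (tn_mul (tn_mul hFm.tn hW) hFn.tn)
      (smooth_pos hFm hW hFn _ _ (hr₀.comp (Fin.strictMono_succ))
        (hc₀.comp (Fin.strictMono_succAbove j)) hj)
      (smooth_pos hFm hW hFn _ _ hr₀ hc₀ hne) r r' c c' hr hr' hc hc' hrr hcc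
    exact sub_nonneg.2 this
  · push Not at hz
    rw [hz r c hr hc, hz r c' hr hc']
    simp

end MinorTP

/-- Every `2 × 2` minor of the `(A,B)`-minor matrix `T` of a totally nonnegative
matrix `W` is nonnegative.  Here `a, b : Fin k → ℕ` enumerate the strictly increasing
index sets `A ⊆ {0,…,m-1}` and `B ⊆ {0,…,n-1}`, and `T i j = det W[i+A, j+B]`
whenever the shifted index sets fit inside the ranges of `W`. -/
theorem minor_matrix_two_by_two_minors_nonneg
    {m n k : ℕ} (hk : 1 ≤ k)
    (W : Matrix (Fin m) (Fin n) ℝ) (hW : IsTotallyNonneg W)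
    (a b : Fin k → ℕ) (ha : StrictMono a) (hb : StrictMono b)
    (hA : ∀ p, a p < m) (hB : ∀ q, b q < n)
    (T : ℕ → ℕ → ℝ)
    (hT : ∀ (i j : ℕ) (hri : ∀ p, i + a p < m) (hcj : ∀ q, j + b q < n),
      T i j = (Matrix.of fun p q : Fin k =>
        W ⟨i + a p, hri p⟩ ⟨j + b q, hcj q⟩).det)
    (i₁ i₂ j₁ j₂ : ℕ) (hi : i₁ < i₂) (hj : j₁ < j₂)
    (hrow : ∀ p, i₂ + a p < m) (hcol : ∀ q, j₂ + b q < n) :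
    0 ≤ T i₁ j₁ * T i₂ j₂ - T i₁ j₂ * T i₂ j₁ := by
  obtain ⟨k, rfl⟩ : ∃ l, k = l + 1 := ⟨k - 1, by omega⟩
  have hrow' : ∀ p, i₁ + a p < m := fun p => by have := hrow p; omega
  have hcol' : ∀ p, j₁ + b p < n := fun p => by have := hcol p; omega
  rw [hT i₁ j₁ hrow' hcol', hT i₂ j₂ hrow hcol, hT i₁ j₂ hrow' hcol, hT i₂ j₁ hrow hcol']
  exact MinorTP.main hW (fun p => ⟨i₁ + a p, hrow' p⟩) (fun p => ⟨i₂ + a p, hrow p⟩)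
    (fun q => ⟨j₁ + b q, hcol' q⟩) (fun q => ⟨j₂ + b q, hcol q⟩)
    (fun p q h => Nat.add_lt_add_left (ha h) _) (fun p q h => Nat.add_lt_add_left (ha h) _)
    (fun p q h => Nat.add_lt_add_left (hb h) _) (fun p q h => Nat.add_lt_add_left (hb h) _)
    (fun p => Nat.add_lt_add_right hi _) (fun p => Nat.add_lt_add_right hj _)
end

section
/- Let $p(x) = \sum_{i=0}^{m} a_i x^i$ be a nonzero real polynomial all of whose complex roots are real and negative. Set $a_i = 0$ for $i < 0$ and $i > m$. Then the polynomial $q(x) = \sum_{i=0}^{m} (a_i^2 - a_{i-1} a_{i+1})\, x^i$ also has only real negative roots, i.e., every complex root of $q$ is a negative real number. -/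
open Polynomial

/-- Monic of degree `n`, all roots in the half plane `Re (u z) ≤ δ`. -/
def HalfPlaneStable (u : ℂ) (δ : ℝ) (n : ℕ) (f : ℂ[X]) : Prop :=
  f.Monic ∧ f.natDegree = n ∧ ∀ z, f.eval z = 0 → (u * z).re ≤ δ

lemma multiset_sum_re_pos (s : Multiset ℂ) (h : ∀ z ∈ s, 0 < z.re) :
    s.sum = 0 ∨ 0 < s.sum.re := by
  induction s using Multiset.induction_on with
  | empty => left; simp
  | cons a s ih =>
    right
    have ha := h a (by simp)
    rcases ih (fun z hz => h z (by simp [hz])) with h0 | h0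
    · simp [h0, ha]
    · simp only [Multiset.sum_cons, Complex.add_re]; linarith

lemma HalfPlaneStable.step {u : ℂ} {δ : ℝ} {n : ℕ} {f : ℂ[X]} (hf : HalfPlaneStable u δ n f)
    (c : ℂ) (hcu : (c * u).re = 0) (hu : u ≠ 0) :
    HalfPlaneStable u δ n (f + C c * derivative f) := by
  obtain ⟨hm, hd, hr⟩ := hf
  have hdeg : (C c * derivative f).degree < f.degree :=
    lt_of_le_of_lt (by rw [← smul_eq_C_mul]; exact degree_smul_le c _) (degree_derivative_lt hm.ne_zero)
  refine ⟨hm.add_of_left hdeg, ?_, ?_⟩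
  · rw [natDegree_eq_of_degree_eq (degree_add_eq_left_of_degree_lt hdeg), hd]
  · intro z hz
    by_contra hlt
    push Not at hlt
    have hfz : f.eval z ≠ 0 := fun h => absurd (hr z h) (not_le.mpr hlt)
    have hs := (IsAlgClosed.splits f).eval_derivative_div_eval_of_ne_zero hfz
    have key := multiset_sum_re_pos (f.roots.map fun r ↦ u⁻¹ * (1 / (z - r))) (by
      intro w hw
      obtain ⟨r, hr', rfl⟩ := Multiset.mem_map.mp hw
      have h1 := hr r (mem_roots'.mp hr').2
      have h2 : 0 < (u * (z - r)).re := by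
        rw [mul_sub, Complex.sub_re]; linarith
      have h3 : u⁻¹ * (1 / (z - r)) = (u * (z - r))⁻¹ := by
        rw [mul_inv, one_div]
      rw [h3, Complex.inv_re]
      apply div_pos h2
      rw [Complex.normSq_pos]
      intro h0; rw [h0] at h2; simp at h2)
    rw [Multiset.sum_map_mul_left, ← hs] at key
    set σ := u⁻¹ * (eval z (derivative f) / eval z f) with hσ
    have e : 1 + (c * u) * σ = 0 := by
      simp only [eval_add, eval_mul, eval_C] at hz
      rw [hσ]; field_simp; linear_combination hz
    rcases key with h0 | h0
    · rw [h0] at e; simp at e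
    · have e1 := congrArg Complex.re e
      have e2 := congrArg Complex.im e
      simp only [Complex.add_re, Complex.add_im, Complex.mul_im (c*u), Complex.mul_re (c*u), hcu, Complex.one_re, Complex.one_im, Complex.zero_re, Complex.zero_im] at e1 e2
      have : (c*u).im = 0 := by
        rcases mul_eq_zero.mp (show (c*u).im * σ.re = 0 by linarith) with h | h
        · exact h
        · linarith
      rw [this] at e1; simp at e1

/-- Second order step: applying (D^2 + ρ) gives ρ times a stable polynomial. -/
lemma HalfPlaneStable.step2 {δ : ℝ} {n : ℕ} {f : ℂ[X]} (hf : HalfPlaneStable 1 δ n f)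
    (ρ : ℝ) (hρ : 0 < ρ) :
    ∃ g, HalfPlaneStable 1 δ n g ∧ derivative (derivative f) + C (ρ : ℂ) * f = C (ρ : ℂ) * g := by
  set c : ℝ := (√ρ)⁻¹ with hc
  have h1 := (hf.step (Complex.I * c) (by simp) one_ne_zero).step (-(Complex.I * c)) (by simp)
    one_ne_zero
  refine ⟨_, h1, ?_⟩
  have hcc : ρ * (c * c) = 1 := by
    rw [hc, ← mul_inv, Real.mul_self_sqrt hρ.le, mul_inv_cancel₀ hρ.ne']
  have hcc' : C (ρ : ℂ) * (C (c : ℂ) * C (c : ℂ)) = 1 := by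
    rw [← C_mul, ← C_mul]; norm_cast; rw [hcc]; simp
  have hI : C Complex.I * C Complex.I = -1 := by
    rw [← C_mul]; simp
  simp only [derivative_add, derivative_mul, derivative_C, C_neg, C_mul, zero_mul, zero_add]
  linear_combination (-derivative (derivative f) ) * hcc' + C (ρ:ℂ) * (C (c:ℂ) * C (c:ℂ)) * derivative (derivative f) * hI

lemma HalfPlaneStable.stepMulti {δ : ℝ} {n : ℕ} (s : Multiset ℂ)
    (hs : ∀ z ∈ s, ∃ x : ℝ, x < 0 ∧ z = x) {f : ℂ[X]} (hf : HalfPlaneStable 1 δ n f) :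
    ∃ g, HalfPlaneStable 1 δ n g ∧
      aeval ((derivative : ℂ[X] →ₗ[ℂ] ℂ[X]) ^ 2) (s.map (fun a => X - C a)).prod f
        = C ((s.map (fun a => X - C a)).prod.eval 0) * g := by
  induction s using Multiset.induction_on with
  | empty => exact ⟨f, hf, by simp⟩
  | cons a s ih =>
    obtain ⟨g, hg, e⟩ := ih (fun z hz => hs z (by simp [hz]))
    obtain ⟨x, hx, rfl⟩ := hs a (by simp)
    obtain ⟨g', hg', e'⟩ := hg.step2 (-x) (by linarith)
    refine ⟨g', hg', ?_⟩
    rw [Multiset.map_cons, Multiset.prod_cons, map_mul, Module.End.mul_apply, e]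
    have : (aeval ((derivative : ℂ[X] →ₗ[ℂ] ℂ[X]) ^ 2)) (X - C (x:ℂ)) g = C ((-x : ℝ) : ℂ) * g' := by
      rw [← e']
      simp [pow_two, Module.algebraMap_end_apply, sub_eq_add_neg, smul_eq_C_mul]
    rw [← smul_eq_C_mul, map_smul, this, eval_mul]
    simp only [smul_eq_C_mul, C_mul]
    simp
    ring

lemma HalfPlaneStable.stepPoly {δ : ℝ} {n : ℕ} (G : ℂ[X]) (hG : G.eval 0 = 1)
    (hs : ∀ z, G.eval z = 0 → ∃ x : ℝ, x < 0 ∧ z = x) {f : ℂ[X]} (hf : HalfPlaneStable 1 δ n f) :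
    HalfPlaneStable 1 δ n (aeval ((derivative : ℂ[X] →ₗ[ℂ] ℂ[X]) ^ 2) G f) := by
  obtain ⟨g, hg, e⟩ := HalfPlaneStable.stepMulti G.roots
    (fun z hz => hs z (mem_roots'.mp hz).2) hf
  have h := (IsAlgClosed.splits G).eq_prod_roots
  have : aeval ((derivative : ℂ[X] →ₗ[ℂ] ℂ[X]) ^ 2) G f = g := by
    rw [h, map_mul, Module.End.mul_apply, e]
    rw [h, eval_mul, eval_C] at hG
    rw [aeval_C, Module.algebraMap_end_apply, smul_eq_C_mul, ← mul_assoc, ← C_mul, hG]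
    simp
  rwa [this]

/-- Normalised Laguerre polynomial. -/
noncomputable def lagPoly (N : ℕ) : ℂ[X] :=
  ∑ k ∈ Finset.range (N + 1), C (((N.choose k : ℝ) / ((k + 1).factorial : ℝ) : ℝ) : ℂ) * X ^ k

noncomputable def opPow (N j : ℕ) : ℂ[X] :=
  ((1 + (derivative : ℂ[X] →ₗ[ℂ] ℂ[X])) ^ j) (X ^ (N + 1))

lemma opPow_stable (u : ℂ) (hu : u ≠ 0) (hre : u.re = 0) (N j : ℕ) :
    HalfPlaneStable u 0 (N + 1) (opPow N j) := by
  induction j with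
  | zero =>
    refine ⟨by simp [opPow, monic_X_pow], by simp [opPow], ?_⟩
    intro z hz
    simp [opPow] at hz
    simp [hz]
  | succ j ih =>
    have := ih.step 1 (by simpa using hre) hu
    convert this using 1
    simp [opPow, pow_succ']

lemma opPow_eq (N : ℕ) : opPow N N = C ((N + 1).factorial : ℂ) * (X * lagPoly N) := by
  rw [opPow, (Commute.one_left _).add_pow, LinearMap.sum_apply, lagPoly, Finset.mul_sum,
    Finset.mul_sum]
  refine Finset.sum_congr rfl fun k hk => ?_
  have hk' : k ≤ N := by simpa [Nat.lt_succ_iff] using hk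
  have h1 : (1 ^ k * (derivative : ℂ[X] →ₗ[ℂ] ℂ[X]) ^ (N - k) * ((N.choose k : ℕ) : Module.End ℂ ℂ[X])) (X ^ (N+1))
      = (N.choose k) • (derivative^[N - k] (X ^ (N+1))) := by
    rw [one_pow, one_mul, Module.End.mul_apply, Module.End.natCast_apply, map_nsmul, Module.End.pow_apply]
  rw [h1, iterate_derivative_X_pow_eq_smul]
  have h2 : N + 1 - (N - k) = k + 1 := by omega
  have h3 : ((N+1).descFactorial (N-k) : ℂ) * ((k+1).factorial : ℂ) = ((N+1).factorial : ℂ) := by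
    have := Nat.factorial_mul_descFactorial (n := N+1) (k := N-k) (by omega)
    rw [h2] at this
    rw [← this]; push_cast; ring
  have h4 : ((k+1).factorial : ℂ) ≠ 0 := by exact_mod_cast Nat.factorial_ne_zero _
  rw [h2, ← h3]
  simp only [nsmul_eq_mul, smul_eq_C_mul]
  rw [show ((N.choose k : ℕ) : ℂ[X]) = C (N.choose k : ℂ) by simp]
  have : C (((N+1).descFactorial (N-k) : ℂ) * ((k+1).factorial : ℂ)) * (X * (C (((N.choose k : ℝ) / ((k + 1).factorial : ℝ) : ℝ) : ℂ) * X ^ k)) = C (((N+1).descFactorial (N-k) : ℂ) * ((k+1).factorial : ℂ) * (((N.choose k : ℝ) / ((k + 1).factorial : ℝ) : ℝ) : ℂ)) * X^(k+1) := by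
    rw [C_mul (a := _ * _)]; ring
  rw [this, ← mul_assoc]
  rw [← C_mul]
  congr 2
  push_cast
  field_simp

lemma lagPoly_eval_real (N : ℕ) (x : ℝ) (hx : 0 ≤ x) : (lagPoly N).eval (x : ℂ) ≠ 0 := by
  have : (lagPoly N).eval (x : ℂ) = ((∑ k ∈ Finset.range (N + 1),
      (N.choose k : ℝ) / ((k + 1).factorial : ℝ) * x ^ k : ℝ) : ℂ) := by
    rw [lagPoly, eval_finsetSum]; push_cast
    simp
  rw [this]
  norm_cast
  apply ne_of_gt
  rw [Finset.sum_range_succ']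
  have : 0 ≤ ∑ k ∈ Finset.range N, (N.choose (k+1) : ℝ) / ((k + 1 + 1).factorial : ℝ) * x ^ (k+1) :=
    Finset.sum_nonneg fun k _ => by positivity
  simp
  linarith

lemma lagPoly_roots (N : ℕ) (z : ℂ) (hz : (lagPoly N).eval z = 0) :
    ∃ x : ℝ, x < 0 ∧ z = x := by
  have h : (opPow N N).eval z = 0 := by rw [opPow_eq]; simp [hz]
  have h1 := (opPow_stable Complex.I Complex.I_ne_zero (by simp) N N).2.2 z h
  have h2 := (opPow_stable (-Complex.I) (by simp) (by simp) N N).2.2 z h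
  simp at h1 h2
  have him : z.im = 0 := le_antisymm h2 h1
  have hzr : z = (z.re : ℂ) := Complex.ext (by simp) (by simp [him])
  refine ⟨z.re, ?_, hzr⟩
  by_contra hneg
  push Not at hneg
  rw [hzr] at hz
  exact lagPoly_eval_real N _ hneg hz

lemma choose_tendsto (k : ℕ) :
    Filter.Tendsto (fun N : ℕ => (N.choose k : ℝ) / ((k+1).factorial : ℝ) * (1 / (N:ℝ)) ^ k) Filter.atTop
      (nhds (1 / ((k.factorial : ℝ) * ((k+1).factorial : ℝ)))) := by
  have h := (isEquivalent_choose k)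
  rw [Asymptotics.isEquivalent_iff_tendsto_one] at h
  · have h2 := h.mul_const (1 / ((k.factorial : ℝ) * ((k+1).factorial : ℝ)))
    rw [one_mul] at h2
    refine h2.congr' ?_
    filter_upwards [Filter.eventually_gt_atTop 0] with N hN
    have : (N:ℝ) ≠ 0 := by positivity
    have h3 : (k.factorial : ℝ) ≠ 0 := by positivity
    have h4 : ((k+1).factorial : ℝ) ≠ 0 := by positivity
    simp only [Pi.div_apply, one_div, inv_pow]
    field_simp
  · filter_upwards [Filter.eventually_gt_atTop 0] with N hN
    positivity

lemma HalfPlaneStable.norm_le {ε : ℝ} (hε : 0 < ε) {n : ℕ} {f : ℂ[X]}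
    (hf : HalfPlaneStable 1 (-ε) n f) : ε ^ n ≤ ‖f.eval 0‖ := by
  obtain ⟨hm, hd, hr⟩ := hf
  have hsp := IsAlgClosed.splits f
  have h := hsp.eq_prod_roots_of_monic hm
  have hc := hsp.natDegree_eq_card_roots
  have gen : ∀ s : Multiset ℂ, (∀ z ∈ s, z.re ≤ -ε) →
      ε ^ (Multiset.card s) ≤ ‖((s.map (fun a => X - C a)).prod).eval 0‖ := by
    intro s
    induction s using Multiset.induction_on with
    | empty => intro _; simp
    | cons a s ih =>
      intro hs
      have h1 := ih (fun z hz => hs z (by simp [hz]))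
      have h2 := hs a (by simp)
      have h3 : ε ≤ ‖a‖ := by
        have := (abs_le.mp (Complex.abs_re_le_norm a)).1
        linarith
      rw [Multiset.map_cons, Multiset.prod_cons, eval_mul, norm_mul, Multiset.card_cons, pow_succ']
      refine mul_le_mul ?_ h1 (by positivity) (by positivity)
      simpa using h3
  rw [← hd, hc]
  conv_rhs => rw [h]
  exact gen _ fun z hz => by simpa using hr z (mem_roots'.mp hz).2

lemma catalan_sum_ne_zero (f : ℂ[X]) (hm : f.Monic) (hr : ∀ z, f.eval z = 0 → z.re < 0) :
    ∑ k ∈ Finset.range (f.natDegree + 1),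
      ((1 / ((k.factorial : ℝ) * ((k+1).factorial : ℝ)) : ℝ) : ℂ) * (derivative^[2*k] f).eval 0 ≠ 0 := by
  obtain ⟨ε, hε, hεr⟩ : ∃ ε : ℝ, 0 < ε ∧ ∀ z ∈ f.roots, z.re ≤ -ε := by
    have gen : ∀ s : Multiset ℂ, (∀ z ∈ s, z.re < 0) → ∃ ε : ℝ, 0 < ε ∧ ∀ z ∈ s, z.re ≤ -ε := by
      intro s
      induction s using Multiset.induction_on with
      | empty => intro _; exact ⟨1, one_pos, by simp⟩
      | cons a s ih =>
        intro hs
        obtain ⟨e, he, h1⟩ := ih (fun z hz => hs z (by simp [hz]))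
        have h2 := hs a (by simp)
        refine ⟨min e (-a.re), lt_min he (by linarith), ?_⟩
        intro z hz
        rcases Multiset.mem_cons.mp hz with rfl | hz
        · linarith [min_le_right e (-z.re)]
        · linarith [min_le_left e (-a.re), h1 z hz]
    exact gen _ fun z hz => hr z (mem_roots'.mp hz).2
  set n := f.natDegree with hn
  have hf : HalfPlaneStable 1 (-ε) n f :=
    ⟨hm, rfl, fun z hz => by simpa using hεr z (mem_roots'.mpr ⟨hm.ne_zero, hz⟩)⟩
  let T : ℕ → ℂ := fun N => ∑ k ∈ Finset.range (n + 1),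
      (((N.choose k : ℝ) / ((k+1).factorial : ℝ) * (1 / (N:ℝ)) ^ k : ℝ) : ℂ) * (derivative^[2*k] f).eval 0
  have hT : Filter.Tendsto T Filter.atTop (nhds (∑ k ∈ Finset.range (n + 1),
      ((1 / ((k.factorial : ℝ) * ((k+1).factorial : ℝ)) : ℝ) : ℂ) * (derivative^[2*k] f).eval 0)) := by
    refine tendsto_finsetSum _ fun k _ => Filter.Tendsto.mul_const _ ?_
    exact (Complex.continuous_ofReal.tendsto _).comp (choose_tendsto k)
  have hb : ∀ᶠ N in Filter.atTop, ε ^ n ≤ ‖T N‖ := by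
    filter_upwards [Filter.eventually_gt_atTop n] with N hN
    have hN0 : (0:ℝ) < N := by exact_mod_cast (lt_of_le_of_lt (Nat.zero_le n) hN)
    set G : ℂ[X] := (lagPoly N).comp (C ((1 / (N:ℝ) : ℝ) : ℂ) * X) with hG
    have h0 : G.eval 0 = 1 := by
      simp [hG, lagPoly, eval_finsetSum, Finset.sum_range_succ']
    have hGr : ∀ z, G.eval z = 0 → ∃ x : ℝ, x < 0 ∧ z = x := by
      intro z hz
      rw [hG, eval_comp] at hz
      obtain ⟨x, hx, e⟩ := lagPoly_roots N _ hz
      refine ⟨N * x, by nlinarith, ?_⟩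
      simp at e
      have : (N:ℂ) ≠ 0 := by exact_mod_cast hN0.ne'
      push_cast
      rw [← e]; field_simp
    have h1 := (HalfPlaneStable.stepPoly G h0 hGr hf).norm_le hε
    convert h1 using 2
    have hGe : G = ∑ k ∈ Finset.range (N + 1), C ((((N.choose k : ℝ) / ((k+1).factorial : ℝ) * (1 / (N:ℝ)) ^ k : ℝ)) : ℂ) * X ^ k := by
      rw [hG, lagPoly, sum_comp]
      refine Finset.sum_congr rfl fun k _ => ?_
      rw [mul_comp, C_comp, pow_comp, X_comp, mul_pow, Complex.ofReal_mul, C_mul, Complex.ofReal_pow, C_pow]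
      ring
    rw [hGe, map_sum, LinearMap.sum_apply, eval_finsetSum]
    symm
    have hterm : ∀ k, eval 0 ((aeval ((derivative : ℂ[X] →ₗ[ℂ] ℂ[X]) ^ 2) (C ((((N.choose k : ℝ) / ((k+1).factorial : ℝ) * (1 / (N:ℝ)) ^ k : ℝ)) : ℂ) * X ^ k)) f) = (((N.choose k : ℝ) / ((k+1).factorial : ℝ) * (1 / (N:ℝ)) ^ k : ℝ) : ℂ) * (derivative^[2*k] f).eval 0 := by
      intro k
      rw [map_mul, Module.End.mul_apply, aeval_C, Module.algebraMap_end_apply, eval_smul, smul_eq_mul, map_pow, aeval_X, ← pow_mul, Module.End.pow_apply]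
    rw [Finset.sum_congr rfl fun k _ => hterm k]
    symm
    apply Finset.sum_subset (Finset.range_mono (by omega))
    intro k _ hk
    have : n < 2 * k := by simp at hk; omega
    rw [iterate_derivative_eq_zero this]; simp
  intro hzero
  rw [hzero] at hT
  have := ge_of_tendsto (hT.norm) hb
  simp at this
  exact absurd this (not_le.mpr (by positivity))

lemma natDegree_prod_X_add_C (s : Multiset ℂ) :
    (s.map (fun y => X + C y)).prod.natDegree = Multiset.card s := by
  rw [natDegree_multiset_prod_of_monic]
  · simp
  · intro f hf
    obtain ⟨y, _, rfl⟩ := Multiset.mem_map.mp hf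
    exact monic_X_add_C y

lemma hom_prod (A B : ℂ[X]) (s : Multiset ℂ) :
    (s.map (fun y => A + C y * B)).prod = ∑ m ∈ Finset.range (Multiset.card s + 1),
      C ((s.map (fun y => X + C y)).prod.coeff m) * (A ^ m * B ^ (Multiset.card s - m)) := by
  induction s using Multiset.induction_on with
  | empty => simp
  | cons y s ih =>
    rw [Multiset.map_cons, Multiset.prod_cons, ih, Multiset.map_cons, Multiset.prod_cons,
      Multiset.card_cons]
    set F := (s.map (fun y => X + C y)).prod with hF
    set N := Multiset.card s with hN
    have hdeg : F.coeff (N + 1) = 0 := by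
      apply coeff_eq_zero_of_natDegree_lt
      rw [hF, natDegree_prod_X_add_C]; omega
    have e1 : ∑ m ∈ Finset.range (N + 1), C (F.coeff m) * (A ^ m * B ^ (N + 1 - m))
        = B * ∑ m ∈ Finset.range (N + 1), C (F.coeff m) * (A ^ m * B ^ (N - m)) := by
      rw [Finset.mul_sum]
      refine Finset.sum_congr rfl fun m hm => ?_
      have : N + 1 - m = (N - m) + 1 := by simp at hm; omega
      rw [this, pow_succ]; ring
    have e2 : ∑ m ∈ Finset.range (N + 1 + 1), C (F.coeff m) * (A ^ m * B ^ (N + 1 - m))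
        = B * ∑ m ∈ Finset.range (N + 1), C (F.coeff m) * (A ^ m * B ^ (N - m)) := by
      rw [Finset.sum_range_succ, hdeg, e1]; simp
    have e3 : ∑ m ∈ Finset.range (N + 1 + 1), C ((X * F).coeff m) * (A ^ m * B ^ (N + 1 - m))
        = A * ∑ m ∈ Finset.range (N + 1), C (F.coeff m) * (A ^ m * B ^ (N - m)) := by
      rw [Finset.sum_range_succ', Finset.mul_sum]
      simp only [coeff_X_mul, coeff_X_mul_zero, C_0, zero_mul, add_zero]
      refine Finset.sum_congr rfl fun m hm => ?_
      rw [Nat.add_sub_add_right, pow_succ]; ring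
    have e4 : ∑ m ∈ Finset.range (N + 1 + 1), C (((X + C y) * F).coeff m) * (A ^ m * B ^ (N + 1 - m))
      = ∑ m ∈ Finset.range (N + 1 + 1), C ((X * F).coeff m) * (A ^ m * B ^ (N + 1 - m)) +
       C y * ∑ m ∈ Finset.range (N + 1 + 1), C (F.coeff m) * (A ^ m * B ^ (N + 1 - m)) := by
      rw [Finset.mul_sum, ← Finset.sum_add_distrib]
      refine Finset.sum_congr rfl fun m _ => ?_
      rw [add_mul, coeff_add, coeff_C_mul, C_add, C_mul]; ring
    rw [e4, e3, e2]; ring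

lemma coeff_expand_form (m : ℕ) : ((1 - X ^ 2) * (X ^ 2 + 1) ^ m : ℂ[X])
    = expand ℂ 2 ((1 - X) * (X + 1) ^ m) := by
  simp

lemma coeff_odd (k : ℕ) : ((1 - X ^ 2) * (X ^ 2 + 1) ^ (2 * k + 1) : ℂ[X]).coeff (2 * k + 1) = 0 := by
  rw [coeff_expand_form, coeff_expand two_pos, if_neg (by omega)]

lemma coeff_even (k : ℕ) : ((1 - X ^ 2) * (X ^ 2 + 1) ^ (2 * k) : ℂ[X]).coeff (2 * k)
    = ((1 / ((k.factorial : ℝ) * ((k+1).factorial : ℝ)) : ℝ) : ℂ) * ((2 * k).factorial : ℂ) := by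
  rw [coeff_expand_form, mul_comm 2 k, coeff_expand_mul two_pos, sub_mul, one_mul, coeff_sub]
  cases k with
  | zero => simp
  | succ j =>
    rw [coeff_X_mul, coeff_X_add_one_pow, coeff_X_add_one_pow]
    rw [Nat.cast_choose ℂ (by omega), Nat.cast_choose ℂ (by omega)]
    rw [show (j+1)*2 - (j+1) = j + 1 by omega, show (j+1)*2 - j = j + 2 by omega]
    have h : (j.factorial : ℂ) ≠ 0 := by exact_mod_cast Nat.factorial_ne_zero _
    have h1 : (j : ℂ) + 1 ≠ 0 := by exact_mod_cast Nat.succ_ne_zero j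
    have h2 : (j : ℂ) + 1 + 1 ≠ 0 := by exact_mod_cast Nat.succ_ne_zero (j+1)
    simp only [Nat.factorial_succ (j+1), Nat.factorial_succ j]
    push_cast
    field_simp
    ring

lemma coeff_identity (s : Multiset ℂ) :
    ((1 - X ^ 2) * (s.map (fun y => (X ^ 2 + 1) + C y * X)).prod : ℂ[X]).coeff (Multiset.card s)
    = ∑ k ∈ Finset.range ((s.map (fun y => X + C y)).prod.natDegree + 1),
      ((1 / ((k.factorial : ℝ) * ((k+1).factorial : ℝ)) : ℝ) : ℂ) *
        (derivative^[2*k] (s.map (fun y => X + C y)).prod).eval 0 := by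
  have hcard : (s.map (fun y => X + C y)).prod.natDegree = Multiset.card s :=
    natDegree_prod_X_add_C s
  rw [hom_prod, hcard, Finset.mul_sum, finsetSum_coeff]
  set F := (s.map (fun y => X + C y)).prod with hF
  set n := Multiset.card s with hn
  have h1 : ∀ m ∈ Finset.range (n + 1), ((1 - X ^ 2) * (C (F.coeff m) * ((X ^ 2 + 1) ^ m * X ^ (n - m))) : ℂ[X]).coeff n
      = F.coeff m * ((1 - X ^ 2) * (X ^ 2 + 1) ^ m : ℂ[X]).coeff m := by
    intro m hm
    have : n = m + (n - m) := by simp at hm; omega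
    rw [show ((1 - X ^ 2) * (C (F.coeff m) * ((X ^ 2 + 1) ^ m * X ^ (n - m))) : ℂ[X])
      = C (F.coeff m) * (((1 - X ^ 2) * (X ^ 2 + 1) ^ m) * X ^ (n - m)) by ring, coeff_C_mul]
    congr 1
    conv_lhs => rw [this]
    simp only [add_tsub_cancel_left]
    rw [coeff_mul_X_pow]
  rw [Finset.sum_congr rfl h1]
  have h2 : ∑ m ∈ Finset.range (n + 1), F.coeff m * ((1 - X ^ 2) * (X ^ 2 + 1) ^ m : ℂ[X]).coeff m
    = ∑ m ∈ Finset.range (2 * (n + 1)), F.coeff m * ((1 - X ^ 2) * (X ^ 2 + 1) ^ m : ℂ[X]).coeff m := by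
    apply Finset.sum_subset (Finset.range_mono (by omega))
    intro m _ hm
    rw [coeff_eq_zero_of_natDegree_lt (by simp at hm; omega), zero_mul]
  have h3 : ∀ (g : ℕ → ℂ) (K : ℕ), ∑ m ∈ Finset.range (2 * K), g m
      = ∑ k ∈ Finset.range K, (g (2 * k) + g (2 * k + 1)) := by
    intro g K
    induction K with
    | zero => simp
    | succ K ih =>
      rw [show 2 * (K + 1) = 2 * K + 1 + 1 by ring, Finset.sum_range_succ, Finset.sum_range_succ, ih,
        Finset.sum_range_succ]; ring
  rw [h2, h3]
  refine Finset.sum_congr rfl fun k _ => ?_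
  rw [coeff_odd, coeff_even, ← coeff_zero_eq_eval_zero, coeff_iterate_derivative]
  simp [Nat.descFactorial_self]
  ring

/-- `∑ (aₖ² - aₖ₋₁ aₖ₊₁) t^(2k)` as a single coefficient. -/
lemma q_as_coeff (A : ℂ[X]) (n : ℕ) (hA : A.natDegree ≤ n) :
    ((1 - X ^ 2) * (A * reflect n A)).coeff n = ∑ i ∈ Finset.range (n + 1),
      (A.coeff i ^ 2 - if i = 0 then 0 else A.coeff (i - 1) * A.coeff (i + 1)) := by
  have key : ∀ B : ℂ[X], (B * reflect n A).coeff n = ∑ i ∈ Finset.range (n + 1), B.coeff i * A.coeff i := by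
    intro B
    rw [coeff_mul, Finset.Nat.sum_antidiagonal_eq_sum_range_succ_mk]
    refine Finset.sum_congr rfl fun i hi => ?_
    have : i ≤ n := by simp at hi; omega
    simp only [coeff_reflect]
    rw [revAt_le (by omega), Nat.sub_sub_self this]
  rw [sub_mul, one_mul, coeff_sub, key, ← mul_assoc, key, Finset.sum_sub_distrib]
  congr 1
  · exact Finset.sum_congr rfl fun i _ => by ring
  · rw [Finset.sum_range_succ', Finset.sum_range_succ]
    have : A.coeff (n + 1) = 0 := coeff_eq_zero_of_natDegree_lt (by omega)
    simp only [this, mul_zero, ite_self, add_zero]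
    have h0 : (X ^ 2 * A).coeff 0 = 0 := by simp
    rw [h0, zero_mul, add_zero]
    refine Finset.sum_congr rfl fun i _ => ?_
    rw [coeff_X_pow_mul']
    rcases i with _ | i
    · simp
    · simp

lemma prod_reflect (t : ℂ) (ht : t ≠ 0) (s : Multiset ℂ) (hs : ∀ r ∈ s, r ≠ 0) :
    (s.map (fun r => C t * X + C r)).prod.natDegree ≤ Multiset.card s ∧
    (s.map (fun r => C t * X + C r)).prod * reflect (Multiset.card s) (s.map (fun r => C t * X + C r)).prod
     = C (t ^ (Multiset.card s) * s.prod) *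
      ((s.map (fun r => t / r + r / t)).map (fun y => (X ^ 2 + 1) + C y * X)).prod := by
  induction s using Multiset.induction_on with
  | empty => simp
  | cons r s ih =>
    obtain ⟨h1, h2⟩ := ih (fun z hz => hs z (by simp [hz]))
    have hr := hs r (by simp)
    have hd : (C t * X + C r).natDegree ≤ 1 := natDegree_linear_le
    simp only [Multiset.map_cons, Multiset.prod_cons, Multiset.card_cons]
    refine ⟨natDegree_mul_le.trans (by omega), ?_⟩
    rw [add_comm (Multiset.card s) 1, reflect_mul _ _ hd h1]
    have h3 : reflect 1 (C t * X + C r) = C t + C r * X := by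
      rw [reflect_add, reflect_C_mul, reflect_C]
      have : reflect 1 (X : ℂ[X]) = 1 := by
        have := reflect_C_mul_X_pow (R := ℂ) 1 1 (c := 1)
        simpa [revAt_le] using this
      rw [this]; simp
    have h4 : (C t * X + C r) * (C t + C r * X) = C (t * r) * ((X ^ 2 + 1) + C (t / r + r / t) * X) := by
      have : C (t * r) * C (t / r + r / t) = C t * C t + C r * C r := by
        rw [← C_mul, ← C_mul, ← C_mul, ← C_add]; congr 1; field_simp
      calc _ = C (t * r) * (X ^ 2 + 1) + (C t * C t + C r * C r) * X := by rw [C_mul]; ring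
        _ = _ := by rw [← this]; ring
    rw [h3]
    calc _ = ((C t * X + C r) * (C t + C r * X)) * _ := by rw [mul_mul_mul_comm]
      _ = _ := by
        rw [h4, h2, pow_add, pow_one]
        simp only [C_mul]; ring

lemma bridge_ne_zero (s : Multiset ℂ) (hs : ∀ y ∈ s, 0 < y.re) :
    ((1 - X ^ 2) * (s.map (fun y => (X ^ 2 + 1) + C y * X)).prod : ℂ[X]).coeff (Multiset.card s) ≠ 0 := by
  rw [coeff_identity]
  apply catalan_sum_ne_zero
  · exact monic_multiset_prod_of_monic _ _ fun y _ => monic_X_add_C y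
  · intro z hz
    rw [eval_multiset_prod, Multiset.prod_eq_zero_iff] at hz
    simp only [Multiset.map_map, Multiset.mem_map, Function.comp] at hz
    obtain ⟨y, hy, e⟩ := hz
    have h1 := hs y hy
    simp only [eval_add, eval_X, eval_C] at e
    have h2 := congrArg Complex.re e
    simp at h2
    linarith

/-- Brändén's theorem (the McNamara–Sagan/Stanley conjecture): if the nonzero real
polynomial `p = ∑ aᵢ xⁱ` has only real negative roots (every complex root is a
negative real), then so does the polynomial `q = ∑ (aᵢ² - aᵢ₋₁ aᵢ₊₁) xⁱ`, where by
convention `a₋₁ = 0`. -/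
theorem log_concavity_polynomial_real_negative_roots
    (p : ℝ[X]) (hp : p ≠ 0)
    (hroots : ∀ z : ℂ, aeval z p = 0 → ∃ x : ℝ, x < 0 ∧ z = (x : ℂ))
    (q : ℝ[X])
    (hq : q = ∑ i ∈ Finset.range (p.natDegree + 1),
      C ((p.coeff i) ^ 2 -
          (if i = 0 then 0 else p.coeff (i - 1) * p.coeff (i + 1))) * X ^ i) :
    ∀ z : ℂ, aeval z q = 0 → ∃ x : ℝ, x < 0 ∧ z = (x : ℂ) := by
  intro z hz
  by_contra hneg
  -- a square root with positive real part
  by_cases hz0 : z = 0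
  · subst hz0
    have h0 : q.coeff 0 = (p.coeff 0) ^ 2 := by
      rw [hq]; simp [finsetSum_coeff, coeff_X_pow]; rw [← C_pow, coeff_C_zero]
    have h1 : q.coeff 0 = 0 := by
      have : ((q.coeff 0 : ℝ) : ℂ) = 0 := by
        rw [← hz, coeff_zero_eq_aeval_zero]
        simp [aeval_def, eval₂_at_zero, coeff_zero_eq_eval_zero]
      exact_mod_cast this
    have h2 : p.coeff 0 = 0 := by rw [h1] at h0; exact pow_eq_zero_iff two_ne_zero |>.mp h0.symm
    obtain ⟨x, hx, e⟩ := hroots 0 (by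
      simp [aeval_def, eval₂_at_zero, h2])
    have : x = 0 := by exact_mod_cast e.symm
    linarith
  obtain ⟨t, ht, htz⟩ : ∃ t : ℂ, 0 < t.re ∧ t ^ 2 = z := by
    obtain ⟨t, ht⟩ := IsAlgClosed.exists_pow_nat_eq z (n := 2) two_pos
    rcases lt_trichotomy t.re 0 with h | h | h
    · exact ⟨-t, by simpa using h, by rw [neg_sq, ht]⟩
    · exfalso
      apply hneg
      have e : z = ((-(t.im) ^ 2 : ℝ) : ℂ) := by
        rw [← ht]; apply Complex.ext <;> simp [pow_two, h]
      refine ⟨-(t.im) ^ 2, ?_, e⟩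
      have : t.im ≠ 0 := by
        intro h'; rw [h'] at e; simp at e; exact hz0 e
      have := sq_pos_of_ne_zero this
      linarith
    · exact ⟨t, h, ht⟩
  have ht0 : t ≠ 0 := by intro h; simp [h] at ht
  set P : ℂ[X] := p.map (algebraMap ℝ ℂ) with hP
  have hP0 : P ≠ 0 := (Polynomial.map_ne_zero_iff (algebraMap ℝ ℂ).injective).mpr hp
  have hPn : P.natDegree = p.natDegree := natDegree_map _
  have hsp := IsAlgClosed.splits P
  set s : Multiset ℂ := P.roots.map (fun r => -r) with hs
  have hspos : ∀ r ∈ s, ∃ x : ℝ, 0 < x ∧ r = x := by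
    intro r hr
    obtain ⟨r', hr', rfl⟩ := Multiset.mem_map.mp hr
    have h1 := (mem_roots'.mp hr').2
    rw [IsRoot, hP, eval_map_algebraMap] at h1
    obtain ⟨x, hx, rfl⟩ := hroots r' h1
    exact ⟨-x, by linarith, by simp⟩
  have hcard : Multiset.card s = p.natDegree := by
    rw [hs, Multiset.card_map, ← hsp.natDegree_eq_card_roots, hPn]
  set a := P.leadingCoeff with ha
  have ha0 : a ≠ 0 := leadingCoeff_ne_zero.mpr hP0
  set A : ℂ[X] := P.comp (C t * X) with hA
  have hAe : A = C a * (s.map (fun r => C t * X + C r)).prod := by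
    have h := hsp.eq_prod_roots
    rw [hA]
    conv_lhs => rw [h]
    rw [mul_comp, C_comp, multiset_prod_comp, hs, Multiset.map_map, Multiset.map_map]
    congr 3
    funext r
    simp [sub_eq_add_neg]
  have hAc : ∀ i, A.coeff i = (p.coeff i : ℂ) * t ^ i := by
    intro i
    rw [hA, comp_C_mul_X_coeff, hP, coeff_map]; rfl
  obtain ⟨hd, hrefl⟩ := prod_reflect t ht0 s (fun r hr => by
    obtain ⟨x, hx, rfl⟩ := hspos r hr
    exact_mod_cast hx.ne')
  rw [hcard] at hd hrefl
  have hAd : A.natDegree ≤ p.natDegree := by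
    rw [hAe]; exact (natDegree_C_mul_le _ _).trans hd
  have hval : aeval z q = ((1 - X ^ 2) * (A * reflect p.natDegree A)).coeff p.natDegree := by
    rw [q_as_coeff A _ hAd, hq, map_sum]
    refine Finset.sum_congr rfl fun i _ => ?_
    simp only [map_mul, aeval_C, map_pow, aeval_X, hAc, ← htz]
    rcases i with _ | i
    · simp
    · simp
      ring
  have hb := bridge_ne_zero (s.map (fun r => t / r + r / t)) (by
    intro y hy
    obtain ⟨r, hr, rfl⟩ := Multiset.mem_map.mp hy
    obtain ⟨x, hx, rfl⟩ := hspos r hr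
    have h1 : (t / (x:ℂ)).re = t.re / x := by simp
    have h2 : ((x:ℂ) / t).re = x * (t.re / Complex.normSq t) := by
      rw [div_eq_mul_inv, Complex.re_ofReal_mul, Complex.inv_re]
    rw [Complex.add_re, h1, h2]
    have := Complex.normSq_pos.mpr ht0
    positivity)
  rw [Multiset.card_map, hcard] at hb
  rw [hval, hAe, reflect_C_mul] at hz
  set Q := (s.map (fun r => C t * X + C r)).prod with hQ
  rw [show (1 - X ^ 2) * (C a * Q * (C a * reflect p.natDegree Q))
    = C (a * a) * ((1 - X ^ 2) * (Q * reflect p.natDegree Q)) by rw [C_mul]; ring, hrefl,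
    coeff_C_mul, mul_left_comm, coeff_C_mul] at hz
  have hprod : s.prod ≠ 0 := by
    intro h
    rw [Multiset.prod_eq_zero_iff] at h
    obtain ⟨x, hx, e⟩ := hspos 0 h
    have : x = 0 := by exact_mod_cast e.symm
    linarith
  exact mul_ne_zero (mul_ne_zero ha0 ha0) (mul_ne_zero (mul_ne_zero (pow_ne_zero _ ht0) hprod) hb) hz
end
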